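/- Let m ∈ ℕ, k⃗ = (kₙ)_{n∈ℕ} an increasing sequence of positive integers, r, s ∈ ℕ and w⃗ ∈ L^∞(Σ,k⃗;υ). If L^m(Σ,k⃗;υ) = A₁ ∪ … ∪ A_r and L^m(Σ,k⃗) = C₁ ∪ … ∪ C_s, then there exist an extraction u⃗ ≺ w⃗ and indices 1 ≤ i₀ ≤ r, 1 ≤ j₀ ≤ s such that {(z₁,…,z_m) : z₁ < … < z_m, each zᵢ ∈ EV(u⃗)} ⊆ A_{i₀} and {(z₁,…,z_m) : z₁ < … < z_m, each zᵢ ∈ E(u⃗)} ⊆ C_{j₀}. -/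

import Mathlib

namespace Farmaki

/-- A located word over the alphabet `Σ ∪ {υ}`: positions are natural numbers,
`none` means the position is not in the domain, `some 0` is the variable `υ`,
and `some a` for `a ≥ 1` is the letter `αₐ`. -/
abbrev LWord := ℕ → Option ℕ

/-- The domain of a located word. -/
def dom (w : LWord) : Set ℕ := {n | w n ≠ none}

/-- `min dom(w)`. -/
noncomputable def minDom (w : LWord) : ℕ := sInf (dom w)

/-- A variable ω-located word over `Σ` dominated by `k`. -/
def IsVarWord (k : ℕ → ℕ) (w : LWord) : Prop :=
  (dom w).Finite ∧ (dom w).Nonempty ∧ (∀ n a, w n = some a → a ≤ k n) ∧ ∃ n, w n = some 0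

/-- A (constant) ω-located word over `Σ` dominated by `k`. -/
def IsConstWord (k : ℕ → ℕ) (w : LWord) : Prop :=
  (dom w).Finite ∧ (dom w).Nonempty ∧ ∀ n a, w n = some a → 1 ≤ a ∧ a ≤ k n

/-- `w < u` iff `max dom(w) < min dom(u)`. -/
def wlt (w u : LWord) : Prop := ∀ m n, w m ≠ none → u n ≠ none → m < n

/-- Concatenation `w ⋆ u` of located words (union of graphs, `w` taking precedence). -/
def star (w u : LWord) : LWord := fun n => (w n).orElse (fun _ => u n)

/-- The empty located word. -/
def emptyW : LWord := fun _ => none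

/-- The substitution `T_p`: for `p ≥ 1` it replaces the variable `υ` at position `n`
by `α_p` if `k n ≥ p` and by `α_{k n}` otherwise; `T_0` is the identity. -/
def Tp (k : ℕ → ℕ) (p : ℕ) (w : LWord) : LWord := fun n =>
  match w n with
  | none => none
  | some a => if a = 0 ∧ p ≠ 0 then some (min p (k n)) else some a

/-- The combination `T_{p 0}(w (n 0)) ⋆ ⋯ ⋆ T_{p l}(w (n l))`. -/
def comb (k : ℕ → ℕ) (w : ℕ → LWord) {l : ℕ} (n p : Fin (l + 1) → ℕ) : LWord :=
  (List.ofFn fun i => Tp k (p i) (w (n i))).foldr star emptyW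

/-- `EV(w⃗)`: the extracted variable ω-located words of a sequence `w⃗`. -/
def EV (k : ℕ → ℕ) (w : ℕ → LWord) : Set LWord :=
  {u | ∃ (l : ℕ) (n p : Fin (l + 1) → ℕ), StrictMono n ∧
    (∀ i, p i ≤ k (n i)) ∧ (∃ i, p i = 0) ∧ u = comb k w n p}

/-- `E(w⃗)`: the extracted (constant) ω-located words of a sequence `w⃗`. -/
def Econst (k : ℕ → ℕ) (w : ℕ → LWord) : Set LWord :=
  {u | ∃ (l : ℕ) (n p : Fin (l + 1) → ℕ), StrictMono n ∧
    (∀ i, 1 ≤ p i ∧ p i ≤ k (n i)) ∧ u = comb k w n p}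

/-- An infinite orderly sequence of variable ω-located words, i.e. a member of
`L^∞(Σ,k⃗;υ)`. -/
def OrderlyVar (k : ℕ → ℕ) (w : ℕ → LWord) : Prop :=
  (∀ n, IsVarWord k (w n)) ∧ ∀ n, wlt (w n) (w (n + 1))

/-- `u⃗ ≺ w⃗`: `u⃗` is an extraction of `w⃗`. -/
def Extraction (k : ℕ → ℕ) (u w : ℕ → LWord) : Prop :=
  OrderlyVar k u ∧ ∀ n, u n ∈ EV k w

/-- A finite orderly sequence of variable ω-located words, i.e. a member of
`L^{<∞}(Σ,k⃗;υ)` (the empty list is allowed). -/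
def FinOrderlyV (k : ℕ → ℕ) (ws : List LWord) : Prop :=
  (∀ w ∈ ws, IsVarWord k w) ∧ ws.Chain' wlt

/-- A finite orderly sequence of (constant) ω-located words, i.e. a member of
`L^{<∞}(Σ,k⃗)` (the empty list is allowed). -/
def FinOrderlyC (k : ℕ → ℕ) (ws : List LWord) : Prop :=
  (∀ w ∈ ws, IsConstWord k w) ∧ ws.Chain' wlt

end Farmaki

namespace Farmaki

open Filter

section Semigroup

variable {M : Type*} [Semigroup M] [TopologicalSpace M] [CompactSpace M]

/-- A nonempty closed subsemigroup contains a closed left ideal that is minimal. -/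
theorem exists_minimal_left_ideal (S : Set M) (hne : S.Nonempty) (hcl : IsClosed S)
    (hmul : ∀ x ∈ S, ∀ y ∈ S, x * y ∈ S) :
    ∃ L ⊆ S, Minimal
      (· ∈ {L : Set M | L ⊆ S ∧ IsClosed L ∧ L.Nonempty ∧ ∀ x ∈ S, ∀ y ∈ L, x * y ∈ L}) L := by
  refine zorn_superset_nonempty _ (fun c hcs hc hcne => ?_) S ⟨subset_rfl, hcl, hne, hmul⟩
  refine ⟨⋂₀ c, ⟨?_, isClosed_sInter fun t ht => (hcs ht).2.1, ?_, ?_⟩,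
    fun s hs => Set.sInter_subset_of_mem hs⟩
  · obtain ⟨t, ht⟩ := hcne
    exact (Set.sInter_subset_of_mem ht).trans (hcs ht).1
  · exact IsCompact.nonempty_sInter_of_directed_nonempty_isCompact_isClosed (hS := hcne.to_subtype)
      (IsChain.directedOn hc.symm) (fun t ht => (hcs ht).2.2.1)
      (fun t ht => (hcs ht).2.1.isCompact) (fun t ht => (hcs ht).2.1)
  · exact fun x hx y hy t ht => (hcs ht).2.2.2 x hx y (hy t ht)

variable [T2Space M]

/-- An idempotent of a closed subsemigroup below which there is no other idempotent. -/
theorem exists_minimal_idempotent (hcont : ∀ r : M, Continuous (· * r)) (S : Set M)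
    (hne : S.Nonempty) (hcl : IsClosed S) (hmul : ∀ x ∈ S, ∀ y ∈ S, x * y ∈ S) :
    ∃ c ∈ S, c * c = c ∧ ∀ d ∈ S, d * d = d → d * c = d → c * d = d → d = c := by
  obtain ⟨L, hLS, hL⟩ := exists_minimal_left_ideal S hne hcl hmul
  obtain ⟨-, hLcl, hLne, hLmul⟩ := hL.prop
  obtain ⟨c, hcL, hcc⟩ := exists_idempotent_in_compact_subsemigroup hcont L hLne hLcl.isCompact
    fun x hx y hy => hLmul x (hLS hx) y hy
  refine ⟨c, hLS hcL, hcc, fun d hd hdd hdc hcd => ?_⟩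
  have hdL : d ∈ L := hdc ▸ hLmul d hd c hcL
  have hLd : (· * d) '' S = L := by
    refine hL.eq_of_subset ⟨?_, (hcont d).isClosedMap _ hcl, hne.image _, ?_⟩ ?_
    · rintro _ ⟨x, hx, rfl⟩
      exact hmul x hx d hd
    · rintro x hx _ ⟨y, hy, rfl⟩
      exact ⟨x * y, hmul x hx y hy, mul_assoc _ _ _⟩
    · rintro _ ⟨x, hx, rfl⟩
      exact hLmul x hx d hdL
  obtain ⟨x, -, hx⟩ : c ∈ (· * d) '' S := hLd ▸ hcL
  have hx : x * d = c := hx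
  rw [← hcd, ← hx, mul_assoc, hdd]

/-- In the union of a closed subsemigroup `S` and a closed ideal `T`, every idempotent of `S`
dominates an idempotent of `T`. -/
theorem exists_idempotent_le (hcont : ∀ r : M, Continuous (· * r)) (S T : Set M)
    (hne : T.Nonempty) (hcl : IsClosed T) (hTT : ∀ x ∈ T, ∀ y ∈ T, x * y ∈ T)
    (hST : ∀ x ∈ S, ∀ y ∈ T, x * y ∈ T) (hTS : ∀ x ∈ T, ∀ y ∈ S, x * y ∈ T)
    (c : M) (hc : c ∈ S) (hcc : c * c = c) :
    ∃ v ∈ T, v * v = v ∧ v * c = v ∧ c * v = v := by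
  obtain ⟨e, ⟨x, hx, rfl⟩, he⟩ := exists_idempotent_in_compact_subsemigroup hcont ((· * c) '' T)
    (hne.image _) ((hcont c).isClosedMap _ hcl).isCompact (by
      rintro _ ⟨x, hx, rfl⟩ _ ⟨y, hy, rfl⟩
      exact ⟨x * c * y, hTT _ (hTS x hx c hc) y hy, mul_assoc _ _ _⟩)
  have he : x * c * (x * c) = x * c := he
  refine ⟨c * (x * c), hST c hc _ (hTS x hx c hc), ?_, ?_, ?_⟩
  · calc c * (x * c) * (c * (x * c)) = c * (x * (c * c) * (x * c)) := by simp only [mul_assoc]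
      _ = c * (x * c) := by rw [hcc, he]
  · rw [mul_assoc, mul_assoc, hcc]
  · rw [← mul_assoc, hcc]

end Semigroup

theorem star_assoc (x y z : LWord) : star (star x y) z = star x (star y z) := by
  funext n
  simp only [star]
  cases x n <;> rfl

/-- Located words form a semigroup under concatenation. -/
instance : Semigroup LWord where
  mul := star
  mul_assoc := star_assoc

attribute [local instance] Ultrafilter.mul Ultrafilter.semigroup

theorem mul_def (x y : LWord) : x * y = star x y := rfl

theorem Tp_zero (k : ℕ → ℕ) (x : LWord) : Tp k 0 x = x := by
  funext n
  simp only [Tp]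
  cases x n <;> simp

theorem Tp_star (k : ℕ → ℕ) (p : ℕ) (x y : LWord) :
    Tp k p (star x y) = star (Tp k p x) (Tp k p y) := by
  funext n
  simp only [Tp, star]
  cases x n with
  | none => rfl
  | some a => by_cases h : a = 0 ∧ p ≠ 0 <;> simp [h]

theorem Tp_Tp {k : ℕ → ℕ} (hk : ∀ n, 0 < k n) (p : ℕ) {q : ℕ} (hq : q ≠ 0) (x : LWord) :
    Tp k p (Tp k q x) = Tp k q x := by
  funext n
  have := hk n
  simp only [Tp]
  cases x n with
  | none => rfl
  | some a =>
    by_cases h : a = 0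
    · simp [h, hq, show k n ≠ 0 by omega]
    · simp [h]

theorem Tp_ne_none {k : ℕ → ℕ} {p : ℕ} {x : LWord} {j : ℕ} : Tp k p x j ≠ none ↔ x j ≠ none := by
  simp only [Tp]
  cases x j with
  | none => simp
  | some a => by_cases h : a = 0 ∧ p ≠ 0 <;> simp [h]

theorem star_ne_none {x y : LWord} {j : ℕ} : star x y j ≠ none ↔ x j ≠ none ∨ y j ≠ none := by
  simp only [star]
  cases x j <;> simp

theorem Tp_ne_some_zero {k : ℕ → ℕ} (hk : ∀ n, 0 < k n) {p : ℕ} (hp : p ≠ 0) (x : LWord) (j : ℕ) :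
    Tp k p x j ≠ some 0 := by
  have := hk j
  simp only [Tp]
  cases x j with
  | none => simp
  | some a =>
    by_cases h : a = 0
    · simp [h, hp, show k j ≠ 0 by omega]
    · simp [h]

/-- `Comb k w N z` says that `z` is a combination of substituted terms of `w` of index at
least `N`. -/
inductive Comb (k : ℕ → ℕ) (w : ℕ → LWord) : ℕ → LWord → Prop
  | single {N i p : ℕ} (hi : N ≤ i) (hp : p ≤ k i) : Comb k w N (Tp k p (w i))
  | cons {N i p : ℕ} {z : LWord} (hi : N ≤ i) (hp : p ≤ k i) (hz : Comb k w (i + 1) z) :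
      Comb k w N (star (Tp k p (w i)) z)

namespace Comb

variable {k : ℕ → ℕ} {w : ℕ → LWord} {N : ℕ} {z : LWord}

theorem mono {N' : ℕ} (h : Comb k w N z) (hN : N' ≤ N) : Comb k w N' z := by
  cases h with
  | single hi hp => exact single (hN.trans hi) hp
  | cons hi hp hz => exact cons (hN.trans hi) hp hz

theorem star_right (h : Comb k w N z) :
    ∃ N', ∀ y, Comb k w N' y → Comb k w N (star z y) := by
  induction h with
  | @single N i p hi hp => exact ⟨i + 1, fun y hy => cons hi hp hy⟩
  | cons hi hp hz ih =>
    obtain ⟨N', hN'⟩ := ih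
    exact ⟨N', fun y hy => star_assoc _ _ _ ▸ cons hi hp (hN' y hy)⟩

theorem subst (hk : ∀ n, 0 < k n) (hmono : Monotone k) (h : Comb k w N z) {p : ℕ} (hp : p ≤ k N) :
    Comb k w N (Tp k p z) := by
  have key : ∀ {M i q : ℕ}, M ≤ i → p ≤ k M → q ≤ k i →
      ∃ q' ≤ k i, Tp k p (Tp k q (w i)) = Tp k q' (w i) := by
    intro M i q hi hpM hq
    rcases eq_or_ne q 0 with rfl | hq0
    · exact ⟨p, hpM.trans (hmono hi), by rw [Tp_zero]⟩
    · exact ⟨q, hq, Tp_Tp hk p hq0 _⟩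
  induction h with
  | single hi hq =>
    obtain ⟨q', hq', h⟩ := key hi hp hq
    exact h ▸ single hi hq'
  | cons hi hq hz ih =>
    obtain ⟨q', hq', h⟩ := key hi hp hq
    rw [Tp_star, h]
    exact cons hi hq' (ih (hp.trans (hmono (hi.trans (Nat.le_succ _)))))

/-- A combination contains the domain of its leading term. -/
theorem exists_first (h : Comb k w N z) :
    ∃ n, Comb k w n z ∧ ∀ j, w n j ≠ none → z j ≠ none := by
  cases h with
  | @single _ i p hi hp => exact ⟨i, single le_rfl hp, fun j hj => Tp_ne_none.2 hj⟩
  | @cons _ i p z hi hp hz =>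
    exact ⟨i, cons le_rfl hp hz, fun j hj => star_ne_none.2 (.inl (Tp_ne_none.2 hj))⟩

/-- Every position of a combination comes from a term contributing its whole domain. -/
theorem exists_of_ne_none (h : Comb k w N z) {j : ℕ} (hj : z j ≠ none) :
    ∃ i, N ≤ i ∧ w i j ≠ none ∧ ∀ j', w i j' ≠ none → z j' ≠ none := by
  induction h with
  | @single N i p hi hp => exact ⟨i, hi, Tp_ne_none.1 hj, fun j hj => Tp_ne_none.2 hj⟩
  | @cons N i p z hi hp hz ih =>
    rcases star_ne_none.1 hj with hj | hj
    · exact ⟨i, hi, Tp_ne_none.1 hj, fun j hj => star_ne_none.2 (.inl (Tp_ne_none.2 hj))⟩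
    · obtain ⟨i', hi', h, h'⟩ := ih hj
      exact ⟨i', by omega, h, fun j hj => star_ne_none.2 (.inr (h' j hj))⟩

/-- Combinations of words that are dominated by `k` are dominated by `k`. -/
theorem isWord (hw : ∀ n, IsVarWord k (w n)) (h : Comb k w N z) :
    (dom z).Finite ∧ (dom z).Nonempty ∧ ∀ n a, z n = some a → a ≤ k n := by
  have key : ∀ i p, (dom (Tp k p (w i))).Finite ∧ (dom (Tp k p (w i))).Nonempty ∧
      ∀ n a, Tp k p (w i) n = some a → a ≤ k n := by
    intro i p
    have hd : dom (Tp k p (w i)) = dom (w i) := Set.ext fun j => Tp_ne_none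
    obtain ⟨h1, h2, h3, -⟩ := hw i
    refine ⟨hd ▸ h1, hd ▸ h2, fun n a ha => ?_⟩
    simp only [Tp] at ha
    cases hn : w i n with
    | none => simp [hn] at ha
    | some b =>
      have := h3 n b hn
      simp only [hn] at ha
      split_ifs at ha <;> simp only [Option.some.injEq] at ha <;> omega
  induction h with
  | single hi hp => exact key _ _
  | @cons N i p z hi hp hz ih =>
    obtain ⟨h1, h2, h3⟩ := key i p
    have hd : dom (star (Tp k p (w i)) z) = dom (Tp k p (w i)) ∪ dom z :=
      Set.ext fun j => star_ne_none
    refine ⟨hd ▸ h1.union ih.1, hd ▸ h2.inl, fun n a ha => ?_⟩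
    simp only [star] at ha
    cases hn : Tp k p (w i) n with
    | none => exact ih.2.2 n a (by simpa [hn] using ha)
    | some b => exact h3 n a (by simpa [hn] using ha)

end Comb

theorem comb_zero (k : ℕ → ℕ) (w : ℕ → LWord) (n p : Fin 1 → ℕ) :
    comb k w n p = Tp k (p 0) (w (n 0)) := by
  funext j
  simp only [comb, List.ofFn_succ, List.ofFn_zero, List.foldr, star, emptyW]
  cases Tp k (p 0) (w (n 0)) j <;> rfl

theorem comb_succ (k : ℕ → ℕ) (w : ℕ → LWord) {l : ℕ} (n p : Fin (l + 2) → ℕ) :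
    comb k w n p = star (Tp k (p 0) (w (n 0))) (comb k w (Fin.tail n) (Fin.tail p)) := by
  rw [comb, List.ofFn_succ, List.foldr_cons]
  rfl

theorem comb_Comb (k : ℕ → ℕ) (w : ℕ → LWord) {l : ℕ} (n p : Fin (l + 1) → ℕ)
    (hn : StrictMono n) (hp : ∀ i, p i ≤ k (n i)) : Comb k w (n 0) (comb k w n p) := by
  induction l with
  | zero =>
    rw [comb_zero]
    exact .single le_rfl (hp 0)
  | succ l ih =>
    rw [comb_succ]
    refine .cons le_rfl (hp 0) ((ih (Fin.tail n) (Fin.tail p) ?_ fun i => hp i.succ).mono ?_)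
    · exact hn.comp (Fin.strictMono_succ)
    · exact hn (Fin.succ_pos 0)

theorem Comb.exists_comb {k : ℕ → ℕ} {w : ℕ → LWord} {N : ℕ} {z : LWord} (h : Comb k w N z) :
    ∃ (l : ℕ) (n p : Fin (l + 1) → ℕ), StrictMono n ∧ N ≤ n 0 ∧ (∀ i, p i ≤ k (n i)) ∧
      z = comb k w n p := by
  induction h with
  | @single N i p hi hp =>
    exact ⟨0, fun _ => i, fun _ => p, fun a b h => absurd h (by omega), hi, fun _ => hp,
      (comb_zero k w (fun _ => i) fun _ => p).symm⟩
  | @cons N i p z hi hp hz ih =>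
    obtain ⟨l, n, q, hn, hN, hq, rfl⟩ := ih
    refine ⟨l + 1, Fin.cons i n, Fin.cons p q, ?_, hi, ?_, ?_⟩
    · rw [Fin.strictMono_iff_lt_succ]
      intro j
      refine Fin.cases ?_ (fun j => ?_) j
      · exact hN
      · rw [← Fin.succ_castSucc]
        exact hn Fin.castSucc_lt_succ
    · exact Fin.cases hp hq
    · rw [comb_succ]
      rfl

theorem comb_ne_some_zero {k : ℕ → ℕ} (hk : ∀ n, 0 < k n) (w : ℕ → LWord) {l : ℕ}
    (n p : Fin (l + 1) → ℕ) (hp : ∀ i, p i ≠ 0) (j : ℕ) : comb k w n p j ≠ some 0 := by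
  induction l with
  | zero =>
    rw [comb_zero]
    exact Tp_ne_some_zero hk (hp 0) _ j
  | succ l ih =>
    rw [comb_succ]
    have h0 := Tp_ne_some_zero hk (hp 0) (w (n 0)) j
    have h1 := ih (Fin.tail n) (Fin.tail p) fun i => hp i.succ
    simp only [star]
    cases h : Tp k (p 0) (w (n 0)) j with
    | none => simpa using h1
    | some a => simpa [h] using h0

theorem Comb.mem_EV {k : ℕ → ℕ} (hk : ∀ n, 0 < k n) {w : ℕ → LWord} {N : ℕ} {z : LWord}
    (h : Comb k w N z) (hz : ∃ j, z j = some 0) : z ∈ EV k w := by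
  obtain ⟨l, n, p, hn, -, hp, rfl⟩ := h.exists_comb
  refine ⟨l, n, p, hn, hp, ?_, rfl⟩
  by_contra! hp0
  obtain ⟨j, hj⟩ := hz
  exact comb_ne_some_zero hk w n p hp0 j hj

theorem Comb.of_mem_EV {k : ℕ → ℕ} {w : ℕ → LWord} {z : LWord} (h : z ∈ EV k w) :
    Comb k w 0 z := by
  obtain ⟨l, n, p, hn, hp, -, rfl⟩ := h
  exact (comb_Comb k w n p hn hp).mono (Nat.zero_le _)

theorem Comb.of_mem_Econst {k : ℕ → ℕ} {w : ℕ → LWord} {z : LWord} (h : z ∈ Econst k w) :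
    Comb k w 0 z := by
  obtain ⟨l, n, p, hn, hp, rfl⟩ := h
  exact (comb_Comb k w n p hn fun i => (hp i).2).mono (Nat.zero_le _)

theorem OrderlyVar.le_of_ne_none {k : ℕ → ℕ} {w : ℕ → LWord} (hw : OrderlyVar k w) {n j : ℕ}
    (hj : w n j ≠ none) : n ≤ j := by
  induction n generalizing j with
  | zero => exact Nat.zero_le _
  | succ n ih =>
    obtain ⟨i, hi⟩ := (hw.1 n).2.1
    exact (ih hi).trans_lt (hw.2 n i j hi hj)

theorem Comb.le_of_ne_none {k : ℕ → ℕ} {w : ℕ → LWord} (hw : OrderlyVar k w) {N : ℕ} {z : LWord}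
    (h : Comb k w N z) {j : ℕ} (hj : z j ≠ none) : N ≤ j := by
  obtain ⟨i, hi, hij, -⟩ := h.exists_of_ne_none hj
  exact hi.trans (hw.le_of_ne_none hij)

/-- The ultrafilters on the combinations of `w` that contain all the tails of `w`. -/
def tailUltrafilters (k : ℕ → ℕ) (w : ℕ → LWord) : Set (Ultrafilter LWord) :=
  {U | ∀ N, ∀ᶠ z in (U : Filter LWord), Comb k w N z}

/-- The tail ultrafilters concentrated on words without the variable. -/
def constUltrafilters (k : ℕ → ℕ) (w : ℕ → LWord) : Set (Ultrafilter LWord) :=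
  {U | U ∈ tailUltrafilters k w ∧ ∀ᶠ z in (U : Filter LWord), ¬ ∃ j, z j = some 0}

/-- The tail ultrafilters concentrated on words containing the variable. -/
def varUltrafilters (k : ℕ → ℕ) (w : ℕ → LWord) : Set (Ultrafilter LWord) :=
  {U | U ∈ tailUltrafilters k w ∧ ∀ᶠ z in (U : Filter LWord), ∃ j, z j = some 0}

theorem isClosed_tailUltrafilters (k : ℕ → ℕ) (w : ℕ → LWord) :
    IsClosed (tailUltrafilters k w) := by
  have : tailUltrafilters k w = ⋂ N, {U | {z | Comb k w N z} ∈ U} := by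
    ext U
    simp only [Set.mem_iInter]
    rfl
  rw [this]
  exact isClosed_iInter fun N => ultrafilter_isClosed_basic _

theorem isClosed_constUltrafilters (k : ℕ → ℕ) (w : ℕ → LWord) :
    IsClosed (constUltrafilters k w) :=
  (isClosed_tailUltrafilters k w).inter (ultrafilter_isClosed_basic _)

theorem isClosed_varUltrafilters (k : ℕ → ℕ) (w : ℕ → LWord) :
    IsClosed (varUltrafilters k w) :=
  (isClosed_tailUltrafilters k w).inter (ultrafilter_isClosed_basic _)

theorem mul_mem_tailUltrafilters {k : ℕ → ℕ} {w : ℕ → LWord} {U V : Ultrafilter LWord}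
    (hU : U ∈ tailUltrafilters k w) (hV : V ∈ tailUltrafilters k w) :
    U * V ∈ tailUltrafilters k w := by
  intro N
  rw [Ultrafilter.eventually_mul]
  filter_upwards [hU N] with x hx
  obtain ⟨N', hN'⟩ := hx.star_right
  filter_upwards [hV N'] with y hy
  exact hN' y hy

theorem mul_mem_constUltrafilters {k : ℕ → ℕ} {w : ℕ → LWord} {U V : Ultrafilter LWord}
    (hU : U ∈ constUltrafilters k w) (hV : V ∈ constUltrafilters k w) :
    U * V ∈ constUltrafilters k w := by
  refine ⟨mul_mem_tailUltrafilters hU.1 hV.1, ?_⟩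
  rw [Ultrafilter.eventually_mul]
  filter_upwards [hU.2] with x hx
  filter_upwards [hV.2] with y hy
  rintro ⟨j, hj⟩
  simp only [mul_def, star] at hj
  cases h : x j with
  | none => exact hy ⟨j, by simpa [h] using hj⟩
  | some a => exact hx ⟨j, by simpa [h] using hj⟩

theorem mul_mem_varUltrafilters_left {k : ℕ → ℕ} {w : ℕ → LWord} {U V : Ultrafilter LWord}
    (hU : U ∈ varUltrafilters k w) (hV : V ∈ tailUltrafilters k w) :
    U * V ∈ varUltrafilters k w := by
  refine ⟨mul_mem_tailUltrafilters hU.1 hV, ?_⟩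
  rw [Ultrafilter.eventually_mul]
  filter_upwards [hU.2] with x ⟨j, hj⟩
  exact .of_forall fun y => ⟨j, by simp [mul_def, star, hj]⟩

theorem exists_dom_bound {x : LWord} (hx : (dom x).Finite) :
    ∃ N, ∀ j, x j ≠ none → j < N := by
  obtain ⟨N, hN⟩ := hx.bddAbove
  exact ⟨N + 1, fun j hj => Nat.lt_succ_of_le (hN hj)⟩

theorem mul_mem_varUltrafilters_right {k : ℕ → ℕ} {w : ℕ → LWord} (hw : OrderlyVar k w)
    {U V : Ultrafilter LWord}
    (hU : U ∈ tailUltrafilters k w) (hV : V ∈ varUltrafilters k w) :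
    U * V ∈ varUltrafilters k w := by
  refine ⟨mul_mem_tailUltrafilters hU hV.1, ?_⟩
  rw [Ultrafilter.eventually_mul]
  filter_upwards [hU 0] with x hx
  obtain ⟨N, hN⟩ := exists_dom_bound (hx.isWord hw.1).1
  filter_upwards [hV.2, hV.1 N] with y ⟨j, hj⟩ hy
  refine ⟨j, ?_⟩
  have hNj : N ≤ j := hy.le_of_ne_none hw (by simp [hj])
  have hxj : x j = none := by
    by_contra h
    exact absurd (hN j h) (not_lt.2 hNj)
  simp [mul_def, star, hxj, hj]

theorem map_Tp_mem_constUltrafilters {k : ℕ → ℕ} (hk : ∀ n, 0 < k n) (hmono : Monotone k)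
    {w : ℕ → LWord} {U : Ultrafilter LWord} (hU : U ∈ tailUltrafilters k w)
    {p n : ℕ} (hp : p ≠ 0) (hpn : p ≤ k n) :
    U.map (Tp k p) ∈ constUltrafilters k w := by
  refine ⟨fun N => ?_, ?_⟩
  · have : ∀ᶠ z in U, Comb k w N (Tp k p z) := by
      filter_upwards [hU (max n N)] with z hz
      exact (hz.subst hk hmono (hpn.trans (hmono (le_max_left _ _)))).mono (le_max_right _ _)
    exact this
  · have : ∀ᶠ z in U, ¬ ∃ j, Tp k p z j = some 0 :=
      .of_forall fun z ⟨j, hj⟩ => Tp_ne_some_zero hk hp z j hj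
    exact this

theorem map_Tp_mul (k : ℕ → ℕ) (p : ℕ) (U V : Ultrafilter LWord) :
    (U * V).map (Tp k p) = U.map (Tp k p) * V.map (Tp k p) := by
  refine Ultrafilter.coe_inj.mp (Filter.ext' fun q => ?_)
  simp only [Ultrafilter.eventually_mul, Ultrafilter.coe_map, eventually_map, mul_def, Tp_star]

theorem map_Tp_of_constUltrafilters {k : ℕ → ℕ} {w : ℕ → LWord} {U : Ultrafilter LWord}
    (hU : U ∈ constUltrafilters k w) (p : ℕ) : U.map (Tp k p) = U := by
  have h : ∀ᶠ z in U, Tp k p z = z := by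
    filter_upwards [hU.2] with z hz
    funext j
    simp only [Tp]
    cases hj : z j with
    | none => rfl
    | some a =>
      have : a ≠ 0 := fun h => hz ⟨j, by rw [hj, h]⟩
      simp [this]
  refine Ultrafilter.coe_inj.mp (Filter.ext' fun q => ?_)
  simp only [Ultrafilter.coe_map, eventually_map]
  exact eventually_congr (h.mono fun z hz => by rw [hz])

/-- A pair of idempotent ultrafilters, one on constant and one on variable words, such that every
substitution maps the second one to the first one. -/
theorem exists_idempotent_pair {k : ℕ → ℕ} (hk : ∀ n, 0 < k n) (hmono : Monotone k)
    {w : ℕ → LWord} (hw : OrderlyVar k w) :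
    ∃ c ∈ constUltrafilters k w, ∃ v ∈ varUltrafilters k w,
      c * c = c ∧ v * v = v ∧ v * c = v ∧ c * v = v ∧
      ∀ n p, p ≠ 0 → p ≤ k n → v.map (Tp k p) = c := by
  have hV : (varUltrafilters k w).Nonempty := by
    refine ⟨(hyperfilter ℕ : Ultrafilter ℕ).map w, fun N => ?_, ?_⟩
    · have : ∀ᶠ i in (hyperfilter ℕ : Filter ℕ), Comb k w N (w i) := by
        have hN : ∀ᶠ i in (hyperfilter ℕ : Filter ℕ), N ≤ i :=
          Nat.hyperfilter_le_atTop (eventually_ge_atTop N)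
        filter_upwards [hN] with i hi
        have := Comb.single (w := w) hi (Nat.zero_le (k i))
        rwa [Tp_zero] at this
      exact this
    · have : ∀ᶠ i in (hyperfilter ℕ : Filter ℕ), ∃ j, w i j = some 0 :=
        .of_forall fun i => (hw.1 i).2.2.2
      exact this
  have hC : (constUltrafilters k w).Nonempty :=
    let ⟨U, hU⟩ := hV
    ⟨_, map_Tp_mem_constUltrafilters hk hmono hU.1 one_ne_zero (hk 0)⟩
  obtain ⟨c, hc, hcc, hmin⟩ := exists_minimal_idempotent Ultrafilter.continuous_mul_left _ hC
    (isClosed_constUltrafilters k w) fun _ hx _ hy => mul_mem_constUltrafilters hx hy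
  obtain ⟨v, hv, hvv, hvc, hcv⟩ := exists_idempotent_le Ultrafilter.continuous_mul_left
    (constUltrafilters k w) _ hV (isClosed_varUltrafilters k w)
    (fun _ hx _ hy => mul_mem_varUltrafilters_left hx hy.1)
    (fun _ hx _ hy => mul_mem_varUltrafilters_right hw hx.1 hy)
    (fun _ hx _ hy => mul_mem_varUltrafilters_left hx hy.1) c hc hcc
  refine ⟨c, hc, v, hv, hcc, hvv, hvc, hcv, fun n p hp hpn => ?_⟩
  have hTc := map_Tp_of_constUltrafilters hc p
  refine hmin _ (map_Tp_mem_constUltrafilters hk hmono hv.1 hp hpn) ?_ ?_ ?_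
  · rw [← map_Tp_mul, hvv]
  · nth_rw 1 [← hTc, ← map_Tp_mul, hvc]
  · nth_rw 1 [← hTc, ← map_Tp_mul, hcv]

/-- If substitutions map `v` into a filter `F` that is stable under concatenation, then there is a
sequence of words in `X` whose combinations from index `n` on lie in `W (b n)`, where `b n` bounds
the positions of the terms before `n`. -/
theorem exists_fusion (k : ℕ → ℕ) (F v : Filter LWord) [v.NeBot]
    (hF : ∀ R ∈ F, ∀ᶠ x in F, ∀ᶠ y in F, star x y ∈ R)
    (hT : ∀ n p, p ≤ k n → Tendsto (Tp k p) v F)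
    (X : Set LWord) (hX : X ∈ v) (hfin : ∀ x ∈ X, (dom x).Finite)
    (htail : ∀ N, ∀ᶠ x in v, ∀ j, x j ≠ none → N ≤ j)
    (W : ℕ → Set LWord) (hW : ∀ N, W N ∈ F) :
    ∃ (u : ℕ → LWord) (b : ℕ → ℕ), (∀ n, u n ∈ X) ∧
      (∀ n j, u n j ≠ none → b n ≤ j ∧ j < b (n + 1)) ∧ Monotone b ∧
      ∀ n z, Comb k u n z → z ∈ W (b n) := by
  have step : ∀ (n : ℕ) (s : {R : Set LWord // R ∈ F} × ℕ),
      ∃ (x : LWord) (s' : {R : Set LWord // R ∈ F} × ℕ), x ∈ X ∧ s.2 ≤ s'.2 ∧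
        (∀ j, x j ≠ none → s.2 ≤ j ∧ j < s'.2) ∧ s'.1.1 ⊆ s.1.1 ∧ s'.1.1 ⊆ W s'.2 ∧
        ∀ p ≤ k n, Tp k p x ∈ s.1.1 ∧ ∀ y ∈ s'.1.1, star (Tp k p x) y ∈ s.1.1 := by
    rintro n ⟨⟨R, hR⟩, N⟩
    have h : ∀ᶠ x in v, ∀ p ∈ Set.Iic (k n), Tp k p x ∈ R ∧ ∀ᶠ y in F, star (Tp k p x) y ∈ R := by
      rw [eventually_all_finite (Set.finite_Iic _)]
      intro p hp
      exact (hT n p hp).eventually (Filter.Eventually.and hR (hF R hR))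
    obtain ⟨x, hx, hxX, hxN⟩ := (h.and (Filter.Eventually.and hX (htail N))).exists
    obtain ⟨N', hN'⟩ := exists_dom_bound (hfin x hxX)
    have hS : {y | ∀ p ∈ Set.Iic (k n), star (Tp k p x) y ∈ R} ∈ F :=
      (eventually_all_finite (Set.finite_Iic _)).2 fun p hp => (hx p hp).2
    refine ⟨x, ⟨⟨_, inter_mem hR (inter_mem (hW (max N N')) hS)⟩, max N N'⟩, hxX,
      le_max_left _ _, fun j hj => ⟨hxN j hj, lt_max_of_lt_right (hN' j hj)⟩,
      fun y hy => hy.1, fun y hy => hy.2.1, fun p hp => ⟨(hx p hp).1, fun y hy => hy.2.2 p hp⟩⟩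
  choose x s' hstep using step
  let st : ℕ → {R : Set LWord // R ∈ F} × ℕ := fun n => n.rec ⟨⟨W 0, hW 0⟩, 0⟩ s'
  have hst : ∀ n, st (n + 1) = s' n (st n) := fun n => rfl
  have hanti : Antitone fun n => (st n).1.1 :=
    antitone_nat_of_succ_le fun n => (hstep n (st n)).2.2.2.1
  refine ⟨fun n => x n (st n), fun n => (st n).2, fun n => (hstep n (st n)).1,
    fun n j hj => (hstep n (st n)).2.2.1 j hj,
    monotone_nat_of_le_succ fun n => (hstep n (st n)).2.1, fun n z hz => ?_⟩
  have hmem : z ∈ (st n).1.1 := by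
    induction hz with
    | @single N i p hi hp => exact hanti hi (((hstep i (st i)).2.2.2.2.2 p hp).1)
    | @cons N i p z hi hp hz ih => exact hanti hi (((hstep i (st i)).2.2.2.2.2 p hp).2 z ih)
  cases n with
  | zero => exact hmem
  | succ n => exact (hstep n (st n)).2.2.2.2.1 hmem

/-- `Large U m D` says that `D` contains the list `[z₁, …, zₘ]` for `U`-almost all `z₁`, …,
for `U`-almost all `zₘ`. -/
def Large {α : Type*} (U : Filter α) : ℕ → Set (List α) → Prop
  | 0, D => [] ∈ D
  | m + 1, D => ∀ᶠ z in U, Large U m {l | z :: l ∈ D}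

theorem Large.mono {α : Type*} {U : Filter α} {m : ℕ} {D D' : Set (List α)} (h : Large U m D)
    (hD : D ⊆ D') : Large U m D' := by
  induction m generalizing D D' with
  | zero => exact hD h
  | succ m ih => exact Filter.Eventually.mono h fun z hz => ih hz fun l hl => hD hl

theorem Large.exists_of_iUnion {α ι : Type*} [Finite ι] {U : Ultrafilter α} {m : ℕ}
    {D : ι → Set (List α)} (h : Large (U : Filter α) m (⋃ i, D i)) :
    ∃ i, Large (U : Filter α) m (D i) := by
  induction m generalizing D with
  | zero => exact Set.mem_iUnion.1 h
  | succ m ih =>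
    refine Ultrafilter.eventually_exists_iff.1 (Filter.Eventually.mono h fun z hz => ih ?_)
    exact hz.mono fun l hl => by simpa using hl

/-- Almost all tuples are orderly. -/
theorem large_orderly {U : Filter LWord} {Q : LWord → Prop} (hQ : ∀ᶠ z in U, Q z)
    (hfin : ∀ z, Q z → (dom z).Finite) (htail : ∀ N, ∀ᶠ z in U, ∀ j, z j ≠ none → N ≤ j)
    {m : ℕ} (hm : 0 < m) :
    Large U m {l | (∀ z ∈ l, Q z) ∧ l.IsChain wlt ∧ l.length = m} := by
  have key : ∀ m x, Q x →
      Large U m {l | (∀ z ∈ x :: l, Q z) ∧ (x :: l).IsChain wlt ∧ l.length = m} := by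
    intro m
    induction m with
    | zero => intro x hx; simp [Large, hx]
    | succ m ih =>
      intro x hx
      obtain ⟨N, hN⟩ := exists_dom_bound (hfin x hx)
      filter_upwards [hQ, htail N] with z hz hzN
      refine (ih z hz).mono fun l hl => ⟨?_, ?_, by simp [hl.2.2]⟩
      · exact List.forall_mem_cons.2 ⟨hx, hl.1⟩
      · exact List.isChain_cons_cons.2 ⟨fun i j hi hj => (hN i hi).trans_le (hzN j hj), hl.2.1⟩
  obtain ⟨m, rfl⟩ := Nat.exists_eq_add_of_lt hm
  rw [zero_add]
  filter_upwards [hQ] with z hz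
  exact (key m z hz).mono fun l hl => ⟨hl.1, hl.2.1, by simp [hl.2.2]⟩

/-- The words dominated by `k` with domain below `N`. -/
def boundedWords (k : ℕ → ℕ) (N : ℕ) : Set LWord :=
  {y | (∀ j, y j ≠ none → j < N) ∧ ∀ j a, y j = some a → a ≤ k j}

theorem finite_boundedWords (k : ℕ → ℕ) (N : ℕ) : (boundedWords k N).Finite := by
  have h : (Set.univ.pi fun j : Fin N => insert none (some '' Set.Iic (k j))).Finite :=
    Set.Finite.pi fun j => ((Set.finite_Iic _).image _).insert _
  refine (h.image fun g j => if hj : j < N then g ⟨j, hj⟩ else none).subset fun y hy => ?_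
  refine ⟨fun j => y j, fun j _ => ?_, ?_⟩
  · cases hj : y j with
    | none => exact .inl hj
    | some a => exact .inr ⟨a, hy.2 j a hj, hj.symm⟩
  · funext j
    by_cases hj : j < N
    · simp [hj]
    · have : y j = none := by
        by_contra h
        exact hj (hy.1 j h)
      simp [hj, this]

theorem finite_lists_of_mem {α : Type*} {B : Set α} (hB : B.Finite) (m : ℕ) :
    {l : List α | l.length < m ∧ ∀ y ∈ l, y ∈ B}.Finite := by
  have := hB.to_subtype
  refine ((List.finite_length_lt B m).image (List.map Subtype.val)).subset ?_
  rintro l ⟨hl, hlB⟩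
  exact ⟨l.attachWith _ hlB, by simpa using hl, by simp⟩

/-- The words `z` such that, whenever a tuple `l` of words below `N` has almost all its
continuations in `D`, so does `l ++ [z]`. -/
def extenders (k : ℕ → ℕ) (U : Filter LWord) (m : ℕ) (D : Set (List LWord)) (N : ℕ) : Set LWord :=
  {z | ∀ l ∈ {l : List LWord | l.length < m ∧ ∀ y ∈ l, y ∈ boundedWords k N},
    Large U (m - l.length - 1 + 1) {t | l ++ t ∈ D} →
      Large U (m - l.length - 1) {t | l ++ z :: t ∈ D}}

theorem extenders_mem (k : ℕ → ℕ) (U : Filter LWord) (m : ℕ) (D : Set (List LWord)) (N : ℕ) :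
    extenders k U m D N ∈ U := by
  refine (eventually_all_finite (finite_lists_of_mem (finite_boundedWords k N) m)).2 fun l _ => ?_
  by_cases h : Large U (m - l.length - 1 + 1) {t | l ++ t ∈ D}
  · exact Filter.Eventually.mono h fun z hz _ => hz
  · exact .of_forall fun z h' => absurd h' h

/-- A set of tuples that is large contains every orderly tuple built from extenders. -/
theorem mem_of_extenders {k : ℕ → ℕ} {U : Filter LWord} {m : ℕ} {D : Set (List LWord)}
    {Y : Set LWord} (hne : ∀ y ∈ Y, (dom y).Nonempty)
    (hdom : ∀ y ∈ Y, ∀ j a, y j = some a → a ≤ k j)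
    (hext : ∀ z ∈ Y, ∃ N, z ∈ extenders k U m D N ∧
      ∀ y ∈ Y, wlt y z → ∀ j, y j ≠ none → j < N)
    (hD : Large U m D) {ws : List LWord} (hY : ∀ z ∈ ws, z ∈ Y) (hws : ws.IsChain wlt)
    (hlen : ws.length = m) : ws ∈ D := by
  have key : ∀ t l : List LWord, (∀ y ∈ l, y ∈ Y) → (∀ z ∈ t, z ∈ Y) → t.IsChain wlt →
      (∀ y ∈ l, ∀ z ∈ t.head?, wlt y z) → l.length + t.length = m →
      Large U t.length {t' | l ++ t' ∈ D} → l ++ t ∈ D := by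
    intro t
    induction t with
    | nil => intro l _ _ _ _ _ h; exact h
    | cons z t ih =>
      intro l hl ht hc hlt hlm hL
      have hz := ht z List.mem_cons_self
      obtain ⟨N, hzN, hN⟩ := hext z hz
      have hzt : m - l.length - 1 = t.length := by simp at hlm; omega
      have hL' : Large U t.length {t' | l ++ z :: t' ∈ D} := by
        have := hzN l ⟨by simp at hlm; omega, fun y hy =>
          ⟨hN y (hl y hy) (hlt y hy z rfl), hdom y (hl y hy)⟩⟩
        rw [hzt] at this
        exact this hL
      have := ih (l ++ [z]) (by simpa [or_imp, forall_and] using ⟨hl, hz⟩)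
        (fun y hy => ht y (List.mem_cons_of_mem _ hy)) hc.tail ?_ (by simp at hlm ⊢; omega)
        (by simpa using hL')
      · simpa using this
      · intro y hy z' hz'
        have hzz' : wlt z z' := by
          cases t with
          | nil => simp at hz'
          | cons a t =>
            obtain rfl : a = z' := by simpa using hz'
            exact (List.isChain_cons_cons.1 hc).1
        rcases List.mem_append.1 hy with hy | hy
        · obtain ⟨i, hi⟩ := hne z hz
          exact fun a b ha hb => (hlt y hy z rfl a i ha hi).trans (hzz' i b hi hb)
        · rwa [List.mem_singleton.1 hy]
  exact key ws [] (by simp) hY hws (by simp) (by simpa using hlen) (by simpa [hlen] using hD)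

/-- If `u` is spread out along the bounds `b`, then a combination following another one has all its
indices after it. -/
theorem exists_bound_of_wlt {k : ℕ → ℕ} {u : ℕ → LWord} {b : ℕ → ℕ}
    (hne : ∀ n, (dom (u n)).Nonempty) (hb : ∀ n j, u n j ≠ none → b n ≤ j ∧ j < b (n + 1))
    (hbm : Monotone b) {z : LWord} (hz : Comb k u 0 z) :
    ∃ n, Comb k u n z ∧ ∀ y, Comb k u 0 y → wlt y z → ∀ j, y j ≠ none → j < b n := by
  obtain ⟨n, hn, hsub⟩ := hz.exists_first
  refine ⟨n, hn, fun y hy hyz j hj => ?_⟩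
  obtain ⟨i, -, hij, hiy⟩ := hy.exists_of_ne_none hj
  obtain ⟨j₀, hj₀⟩ := hne n
  have hlt : ∀ j', u i j' ≠ none → j' < j₀ := fun j' hj' => hyz j' j₀ (hiy j' hj') (hsub j₀ hj₀)
  have hin : i < n := by
    rcases lt_trichotomy i n with h | rfl | h
    · exact h
    · exact absurd (hlt j₀ hj₀) (lt_irrefl _)
    · have h1 := (hb i j hij).1
      have h2 := (hb n j₀ hj₀).2
      have h3 := hbm (Nat.succ_le_of_lt h)
      have h4 := hlt j hij
      simp only [Nat.succ_eq_add_one] at h3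
      omega
  exact (hb i j hij).2.trans_le (hbm hin)

/-- **Corollary 2.10** (Ramsey type partition theorem for ω-located words, dimension `m`).
For finite partitions of `L^m(Σ,k⃗;υ)` and `L^m(Σ,k⃗)` there is an extraction `u⃗ ≺ w⃗`
such that all orderly `m`-tuples from `EV(u⃗)` lie in one cell and all orderly `m`-tuples
from `E(u⃗)` lie in one cell. -/
theorem ramsey_m_dimensional
    (k : ℕ → ℕ) (hk : ∀ n, 0 < k n) (hmono : Monotone k)
    (m : ℕ) (hm : 0 < m) (r s : ℕ) (hr : 0 < r) (hs : 0 < s)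
    (A : Fin r → Set (List LWord)) (C : Fin s → Set (List LWord))
    (hA : ∀ ws : List LWord, FinOrderlyV k ws → ws.length = m → ∃ i, ws ∈ A i)
    (hC : ∀ ws : List LWord, FinOrderlyC k ws → ws.length = m → ∃ j, ws ∈ C j)
    (w : ℕ → LWord) (hw : OrderlyVar k w) :
    ∃ u : ℕ → LWord, Extraction k u w ∧ ∃ (i₀ : Fin r) (j₀ : Fin s),
      (∀ ws : List LWord, FinOrderlyV k ws → ws.length = m →
        (∀ z ∈ ws, z ∈ EV k u) → ws ∈ A i₀) ∧
      (∀ ws : List LWord, FinOrderlyC k ws → ws.length = m →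
        (∀ z ∈ ws, z ∈ Econst k u) → ws ∈ C j₀) := by
  obtain ⟨c, hc, v, hv, hcc, hvv, hvc, hcv, hvT⟩ := exists_idempotent_pair hk hmono hw
  have htail : ∀ U ∈ tailUltrafilters k w, ∀ N, ∀ᶠ z in (U : Filter LWord),
      ∀ j, z j ≠ none → N ≤ j := fun U hU N => (hU N).mono fun z hz j hj => hz.le_of_ne_none hw hj
  have hQv : ∀ᶠ z in (v : Filter LWord), IsVarWord k z := by
    filter_upwards [hv.1 0, hv.2] with z hz hz0
    obtain ⟨h1, h2, h3⟩ := hz.isWord hw.1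
    exact ⟨h1, h2, h3, hz0⟩
  have hQc : ∀ᶠ z in (c : Filter LWord), IsConstWord k z := by
    filter_upwards [hc.1 0, hc.2] with z hz hz0
    obtain ⟨h1, h2, h3⟩ := hz.isWord hw.1
    exact ⟨h1, h2, fun n a ha =>
      ⟨Nat.one_le_iff_ne_zero.2 fun h => hz0 ⟨n, by rw [ha, h]⟩, h3 n a ha⟩⟩
  obtain ⟨i₀, hi₀⟩ : ∃ i, Large (v : Filter LWord) m (A i) :=
    Large.exists_of_iUnion ((large_orderly hQv (fun z hz => hz.1) (htail v hv.1) hm).mono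
      fun l hl => Set.mem_iUnion.2 (hA l ⟨hl.1, hl.2.1⟩ hl.2.2))
  obtain ⟨j₀, hj₀⟩ : ∃ j, Large (c : Filter LWord) m (C j) :=
    Large.exists_of_iUnion ((large_orderly hQc (fun z hz => hz.1) (htail c hc.1) hm).mono
      fun l hl => Set.mem_iUnion.2 (hC l ⟨hl.1, hl.2.1⟩ hl.2.2))
  have hnot : ∀ z, IsVarWord k z → ¬ IsConstWord k z := by
    rintro z ⟨-, -, -, j, hj⟩ hz
    exact absurd (hz.2.2 j 0 hj).1 (by omega)
  obtain ⟨u, b, huX, hub, hbm, huW⟩ := exists_fusion k ((v : Filter LWord) ⊔ c) v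
    (fun R hR => by
      have hmulmem : ∀ U V : Ultrafilter LWord, R ∈ U * V →
          ∀ᶠ x in (U : Filter LWord), ∀ᶠ y in (V : Filter LWord), star x y ∈ R :=
        fun U V h => h
      have hRv : R ∈ v := hR.1
      have hRc : R ∈ c := hR.2
      simp only [eventually_sup]
      exact ⟨(hmulmem v v (by rwa [hvv])).and (hmulmem v c (by rwa [hvc])),
        (hmulmem c v (by rwa [hcv])).and (hmulmem c c (by rwa [hcc]))⟩)
    (fun n p hp => by
      rcases eq_or_ne p 0 with rfl | hp0
      · have : Tp k 0 = id := funext (Tp_zero k)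
        rw [this]
        exact tendsto_id.mono_right le_sup_left
      · have h : Tendsto (Tp k p) v c := by
          rw [Tendsto, ← Ultrafilter.coe_map, hvT n p hp0 hp]
        exact h.mono_right le_sup_right)
    {z | Comb k w 0 z ∧ IsVarWord k z} (Filter.Eventually.and (hv.1 0) hQv)
    (fun x hx => hx.2.1) (htail v hv.1)
    (fun N => {z | (IsVarWord k z → z ∈ extenders k v m (A i₀) N) ∧
      (IsConstWord k z → z ∈ extenders k c m (C j₀) N)})
    (fun N => by
      refine ⟨?_, ?_⟩
      · filter_upwards [hQv, extenders_mem k v m (A i₀) N] with z hz hzN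
        exact ⟨fun _ => hzN, fun h => absurd h (hnot z hz)⟩
      · filter_upwards [hQc, extenders_mem k c m (C j₀) N] with z hz hzN
        exact ⟨fun h => absurd hz (hnot z h), fun _ => hzN⟩)
  have hbound := fun {z} => exists_bound_of_wlt (z := z) (k := k) (fun n => (huX n).2.2.1) hub hbm
  refine ⟨u, ⟨⟨fun n => (huX n).2, fun n i j hi hj =>
    (hub n i hi).2.trans_le (hub (n + 1) j hj).1⟩,
    fun n => (huX n).1.mem_EV hk (huX n).2.2.2.2⟩, i₀, j₀, fun ws hws hlen hmem => ?_,
    fun ws hws hlen hmem => ?_⟩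
  · refine mem_of_extenders (k := k) (Y := {z | Comb k u 0 z ∧ IsVarWord k z}) (fun y hy => hy.2.2.1)
      (fun y hy => hy.2.2.2.1) (fun z hz => ?_) hi₀
      (fun z hz => ⟨.of_mem_EV (hmem z hz), hws.1 z hz⟩) hws.2 hlen
    obtain ⟨n, hn, h⟩ := hbound hz.1
    exact ⟨b n, (huW n z hn).1 hz.2, fun y hy => h y hy.1⟩
  · refine mem_of_extenders (k := k) (Y := {z | Comb k u 0 z ∧ IsConstWord k z})
      (fun y hy => hy.2.2.1) (fun y hy j a ha => (hy.2.2.2 j a ha).2) (fun z hz => ?_) hj₀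
      (fun z hz => ⟨.of_mem_Econst (hmem z hz), hws.1 z hz⟩) hws.2 hlen
    obtain ⟨n, hn, h⟩ := hbound hz.1
    exact ⟨b n, (huW n z hn).2 hz.2, fun y hy => h y hy.1⟩

end Farmaki
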